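/- Perfect reconstruction of the paraunitary LCT filter bank: let h₀, h₁, g₀, g₁, x : ℤ → ℂ be finitely supported with sampling period T, and let x̂ = Σ_{i=0}^{1} gᵢ ∗ up2( down2( hᵢ ∗ x ) ), where down2(u)(n) = u(2n) and up2(y)(2n) = y(n), up2(y)(m) = 0 for odd m. Define H_m(ω) = [[H₀(ω), H₀(ω+π)], [H₁(ω), H₁(ω+π)]], G_m(ω) = [[G₀(ω), G₁(ω)], [G₀(ω+π), G₁(ω+π)]] and A(ω) = diag( exp(−i·d·b·ω²/T²), exp(−i·d·b·(ω+π)²/T²) ), where capital letters denote DTLCTs with sampling period T. Suppose there is δ > 0 with H_m(ω)·H_m(ω)^{*T} = δ·I for all ω ∈ ℝ, and there is an integer K such that G_m(ω) = exp(−i·K·ω)·conj(A(ω))·H_m(ω)^{*T} for all ω ∈ ℝ (conj denotes entrywise complex conjugation and ^{*T} the conjugate transpose). Then X̂(ω) = (δ/2)·exp(−i·K·ω)·X(ω) for all ω ∈ ℝ. -/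

import Mathlib

open Real Complex Matrix

/-- Discrete-time linear canonical transform (constant prefactor omitted). -/
noncomputable def dtlct (a b d T : ℝ) (x : ℤ → ℂ) (ω : ℝ) : ℂ :=
  ∑ᶠ n : ℤ, x n * Complex.exp ((Complex.I / 2) *
    (((a / b) * (n : ℝ) ^ 2 * T ^ 2 - 2 * (n : ℝ) * ω + (d * b / T ^ 2) * ω ^ 2 : ℝ) : ℂ))

/-- LCT convolution at sampling period `T`. -/
noncomputable def lctConv (a b T : ℝ) (h x : ℤ → ℂ) (n : ℤ) : ℂ :=
  ∑ᶠ k : ℤ, h k * x (n - k) *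
    Complex.exp (-Complex.I * (((a * T ^ 2 / b) * (k : ℝ) * ((n : ℝ) - (k : ℝ)) : ℝ) : ℂ))

/-- Downsampling by 2. -/
def down2 (u : ℤ → ℂ) (n : ℤ) : ℂ := u (2 * n)

/-- Upsampling by 2. -/
noncomputable def up2 (y : ℤ → ℂ) (m : ℤ) : ℂ := if 2 ∣ m then y (m / 2) else 0

/-- The analysis modulation matrix `H_m(ω)`. -/
noncomputable def Hmod (a b d T : ℝ) (h₀ h₁ : ℤ → ℂ) (ω : ℝ) : Matrix (Fin 2) (Fin 2) ℂ :=
  !![dtlct a b d T h₀ ω, dtlct a b d T h₀ (ω + Real.pi);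
     dtlct a b d T h₁ ω, dtlct a b d T h₁ (ω + Real.pi)]

/-- The synthesis modulation matrix `G_m(ω)`. -/
noncomputable def Gmod (a b d T : ℝ) (g₀ g₁ : ℤ → ℂ) (ω : ℝ) : Matrix (Fin 2) (Fin 2) ℂ :=
  !![dtlct a b d T g₀ ω, dtlct a b d T g₁ ω;
     dtlct a b d T g₀ (ω + Real.pi), dtlct a b d T g₁ (ω + Real.pi)]

/-- The diagonal chirp matrix `A(ω)`. -/
noncomputable def Amat (b d T : ℝ) (ω : ℝ) : Matrix (Fin 2) (Fin 2) ℂ :=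
  !![Complex.exp (-Complex.I * ((d * b * ω ^ 2 / T ^ 2 : ℝ) : ℂ)), 0;
     0, Complex.exp (-Complex.I * ((d * b * (ω + Real.pi) ^ 2 / T ^ 2 : ℝ) : ℂ))]

theorem finite_support_mul_right {ι : Type*} {x : ι → ℂ} (hx : (Function.support x).Finite)
    (f : ι → ℂ) : (Function.support fun n => x n * f n).Finite :=
  hx.subset (Function.support_mul_subset_left x f)

theorem dtlct_add (a b d T : ℝ) {x y : ℤ → ℂ} (hx : (Function.support x).Finite)
    (hy : (Function.support y).Finite) (ω : ℝ) :
    dtlct a b d T (fun n => x n + y n) ω = dtlct a b d T x ω + dtlct a b d T y ω := by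
  simp only [dtlct, add_mul]
  exact finsum_add_distrib (finite_support_mul_right hx _) (finite_support_mul_right hy _)

theorem finite_support_lctConv (a b T : ℝ) {h x : ℤ → ℂ} (hh : (Function.support h).Finite)
    (hx : (Function.support x).Finite) : (Function.support (lctConv a b T h x)).Finite := by
  refine (Set.Finite.image2 (· + ·) hh hx).subset fun n hn => ?_
  obtain ⟨k, hk⟩ := not_forall.1 fun hzero => hn (finsum_eq_zero_of_forall_eq_zero hzero)
  refine ⟨k, left_ne_zero_of_mul (left_ne_zero_of_mul hk), n - k,
    right_ne_zero_of_mul (left_ne_zero_of_mul hk), ?_⟩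
  simp

theorem lctConv_eq_sum (a b T : ℝ) {h : ℤ → ℂ} (hh : (Function.support h).Finite)
    (x : ℤ → ℂ) (n : ℤ) :
    lctConv a b T h x n = ∑ k ∈ hh.toFinset, h k * x (n - k) *
      Complex.exp (-Complex.I *
        (((a * T ^ 2 / b) * (k : ℝ) * ((n : ℝ) - (k : ℝ)) : ℝ) : ℂ)) := by
  refine finsum_eq_sum_of_support_subset _ fun k hk => ?_
  simpa using left_ne_zero_of_mul (left_ne_zero_of_mul hk)

/-- Convolution theorem for the discrete-time linear canonical transform. -/
theorem dtlct_lctConv (a b d T : ℝ) {h x : ℤ → ℂ} (hh : (Function.support h).Finite)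
    (hx : (Function.support x).Finite) (ω : ℝ) :
    dtlct a b d T (lctConv a b T h x) ω =
      Complex.exp (-(Complex.I / 2) * ((d * b / T ^ 2 * ω ^ 2 : ℝ) : ℂ)) *
        dtlct a b d T h ω * dtlct a b d T x ω := by
  have hsum : dtlct a b d T h ω = ∑ k ∈ hh.toFinset, h k * Complex.exp ((Complex.I / 2) *
      (((a / b) * (k : ℝ) ^ 2 * T ^ 2 - 2 * (k : ℝ) * ω + (d * b / T ^ 2) * ω ^ 2 : ℝ) : ℂ)) := by
    refine finsum_eq_sum_of_support_subset _ fun k hk => ?_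
    simpa using left_ne_zero_of_mul hk
  rw [hsum, Finset.mul_sum, Finset.sum_mul]
  unfold dtlct
  simp only [lctConv_eq_sum a b T hh, Finset.sum_mul]
  rw [finsum_sum_comm]
  · refine Finset.sum_congr rfl fun k _ => ?_
    rw [← finsum_comp_equiv (Equiv.addRight k),
      mul_finsum]
    refine finsum_congr fun m => ?_
    simp only [Equiv.coe_addRight, add_sub_cancel_right]
    have hexp : ∀ p q r s t u v : ℂ, p + q = r + s + t →
        u * v * Complex.exp p * Complex.exp q =
          Complex.exp r * (u * Complex.exp s) * (v * Complex.exp t) := by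
      intro p q r s t u v hpq
      have := congrArg Complex.exp hpq
      simp only [Complex.exp_add] at this
      linear_combination u * v * this
    apply hexp
    push_cast
    ring
  · intro k _
    refine finite_support_mul_right (finite_support_mul_right ?_ _) _
    refine (hx.image (· + k)).subset fun n hn => ⟨n - k, right_ne_zero_of_mul hn, by simp⟩

theorem up2_down2_apply (u : ℤ → ℂ) (n : ℤ) :
    up2 (down2 u) n = (u n + u n * (-1) ^ n) / 2 := by
  unfold up2 down2
  rcases Int.even_or_odd n with hn | hn
  · rw [if_pos hn.two_dvd, Int.mul_ediv_cancel' hn.two_dvd, hn.neg_one_zpow]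
    ring
  · rw [if_neg fun h => Int.not_even_iff_odd.2 hn (even_iff_two_dvd.2 h), hn.neg_one_zpow]
    ring

theorem finite_support_up2_down2 {u : ℤ → ℂ} (hu : (Function.support u).Finite) :
    (Function.support (up2 (down2 u))).Finite := by
  refine hu.subset fun n hn h => hn ?_
  simp [up2_down2_apply, h]

/-- Aliasing formula: decimation followed by expansion averages the spectrum with its shift
by `π`, up to the chirp factor. -/
theorem dtlct_up2_down2 (a b d T : ℝ) {u : ℤ → ℂ} (hu : (Function.support u).Finite) (ω : ℝ) :
    dtlct a b d T (up2 (down2 u)) ω = (dtlct a b d T u ω +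
      Complex.exp ((Complex.I / 2) *
        ((d * b / T ^ 2 * (ω ^ 2 - (ω + Real.pi) ^ 2) : ℝ) : ℂ)) *
        dtlct a b d T u (ω + Real.pi)) / 2 := by
  unfold dtlct
  rw [div_eq_mul_inv (_ + _), mul_finsum, ← finsum_add_distrib (finite_support_mul_right hu _),
    finsum_mul]
  · refine finsum_congr fun n => ?_
    have hexp : (-1 : ℂ) ^ n * Complex.exp ((Complex.I / 2) *
          ((a / b * (n : ℝ) ^ 2 * T ^ 2 - 2 * (n : ℝ) * ω + d * b / T ^ 2 * ω ^ 2 : ℝ) : ℂ)) =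
        Complex.exp ((Complex.I / 2) *
            ((d * b / T ^ 2 * (ω ^ 2 - (ω + Real.pi) ^ 2) : ℝ) : ℂ)) *
          Complex.exp ((Complex.I / 2) *
            ((a / b * (n : ℝ) ^ 2 * T ^ 2 - 2 * (n : ℝ) * (ω + Real.pi) +
              d * b / T ^ 2 * (ω + Real.pi) ^ 2 : ℝ) : ℂ)) := by
      have hpi : (-1 : ℂ) ^ n = Complex.exp (n * (-(Real.pi * Complex.I))) := by
        rw [Complex.exp_int_mul, Complex.exp_neg, Complex.exp_pi_mul_I]
        norm_num
      rw [hpi, ← Complex.exp_add, ← Complex.exp_add]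
      congr 1
      push_cast
      ring
    rw [up2_down2_apply]
    linear_combination u n / 2 * hexp
  · refine (finite_support_mul_right hu fun n => Complex.exp ((Complex.I / 2) *
      ((a / b * (n : ℝ) ^ 2 * T ^ 2 - 2 * (n : ℝ) * (ω + Real.pi) +
        d * b / T ^ 2 * (ω + Real.pi) ^ 2 : ℝ) : ℂ))).subset ?_
    exact Function.support_mul_subset_right _ _

/-- One channel of the filter bank in the transform domain. -/
theorem dtlct_channel (a b d T : ℝ) {g h x : ℤ → ℂ} (hg : (Function.support g).Finite)
    (hh : (Function.support h).Finite) (hx : (Function.support x).Finite) (ω : ℝ) :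
    dtlct a b d T (lctConv a b T g (up2 (down2 (lctConv a b T h x)))) ω =
      Complex.exp (-Complex.I * ((d * b * ω ^ 2 / T ^ 2 : ℝ) : ℂ)) / 2 *
        (dtlct a b d T g ω * dtlct a b d T h ω * dtlct a b d T x ω) +
      Complex.exp (-Complex.I * ((d * b * (ω + Real.pi) ^ 2 / T ^ 2 : ℝ) : ℂ)) / 2 *
        (dtlct a b d T g ω * dtlct a b d T h (ω + Real.pi) *
          dtlct a b d T x (ω + Real.pi)) := by
  have hconv := finite_support_lctConv a b T hh hx
  rw [dtlct_lctConv a b d T hg (finite_support_up2_down2 hconv), dtlct_up2_down2 a b d T hconv,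
    dtlct_lctConv a b d T hh hx, dtlct_lctConv a b d T hh hx]
  have hω : Complex.exp (-Complex.I * ((d * b * ω ^ 2 / T ^ 2 : ℝ) : ℂ)) =
      Complex.exp (-(Complex.I / 2) * ((d * b / T ^ 2 * ω ^ 2 : ℝ) : ℂ)) *
        Complex.exp (-(Complex.I / 2) * ((d * b / T ^ 2 * ω ^ 2 : ℝ) : ℂ)) := by
    rw [← Complex.exp_add]
    congr 1
    push_cast
    ring
  have hshift : Complex.exp (-Complex.I * ((d * b * (ω + Real.pi) ^ 2 / T ^ 2 : ℝ) : ℂ)) =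
      Complex.exp (-(Complex.I / 2) * ((d * b / T ^ 2 * ω ^ 2 : ℝ) : ℂ)) *
        Complex.exp ((Complex.I / 2) *
          ((d * b / T ^ 2 * (ω ^ 2 - (ω + Real.pi) ^ 2) : ℝ) : ℂ)) *
        Complex.exp (-(Complex.I / 2) * ((d * b / T ^ 2 * (ω + Real.pi) ^ 2 : ℝ) : ℂ)) := by
    rw [← Complex.exp_add, ← Complex.exp_add]
    congr 1
    push_cast
    ring
  rw [hω, hshift]
  ring

theorem conjTranspose_mul_self_of_mul_conjTranspose_self {n : Type*} [Fintype n] [DecidableEq n]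
    {H : Matrix n n ℂ} {δ : ℂ} (hδ : δ ≠ 0) (hH : H * Hᴴ = δ • (1 : Matrix n n ℂ)) :
    Hᴴ * H = δ • (1 : Matrix n n ℂ) := by
  have hinv : H * (δ⁻¹ • Hᴴ) = 1 := by
    rw [Matrix.mul_smul, hH, smul_smul, inv_mul_cancel₀ hδ, one_smul]
  rw [← mul_eq_one_comm.1 hinv, Matrix.smul_mul, smul_smul, mul_inv_cancel₀ hδ, one_smul]

/-- Perfect reconstruction of the paraunitary LCT filter bank: if
`H_m(ω)·H_m(ω)^{*T} = δ·I` and `G_m(ω) = e^{−iKω}·conj(A(ω))·H_m(ω)^{*T}`, then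
`X̂(ω) = (δ/2)·e^{−iKω}·X(ω)`. -/
theorem dtlct_perfect_reconstruction
    (a b c d T : ℝ) (hb : 0 < b) (habcd : a * d - b * c = 1) (hT : 0 < T)
    (h₀ h₁ g₀ g₁ x : ℤ → ℂ)
    (hh₀ : (Function.support h₀).Finite) (hh₁ : (Function.support h₁).Finite)
    (hg₀ : (Function.support g₀).Finite) (hg₁ : (Function.support g₁).Finite)
    (hx : (Function.support x).Finite)
    (xhat : ℤ → ℂ)
    (hxhat : ∀ n : ℤ,
      xhat n = lctConv a b T g₀ (up2 (down2 (lctConv a b T h₀ x))) n +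
               lctConv a b T g₁ (up2 (down2 (lctConv a b T h₁ x))) n)
    (δ : ℝ) (hδ : 0 < δ)
    (hPU : ∀ ω : ℝ,
      Hmod a b d T h₀ h₁ ω * (Hmod a b d T h₀ h₁ ω)ᴴ =
        (δ : ℂ) • (1 : Matrix (Fin 2) (Fin 2) ℂ))
    (K : ℤ)
    (hG : ∀ ω : ℝ,
      Gmod a b d T g₀ g₁ ω =
        Complex.exp (-Complex.I * (((K : ℝ) * ω : ℝ) : ℂ)) •
          ((Amat b d T ω).map (starRingEnd ℂ) * (Hmod a b d T h₀ h₁ ω)ᴴ)) :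
    ∀ ω : ℝ,
      dtlct a b d T xhat ω =
        ((δ : ℂ) / 2) * Complex.exp (-Complex.I * (((K : ℝ) * ω : ℝ) : ℂ)) *
          dtlct a b d T x ω := by
  intro ω
  have hδ' : (δ : ℂ) ≠ 0 := by exact_mod_cast hδ.ne'
  have hGH : Gmod a b d T g₀ g₁ ω * Hmod a b d T h₀ h₁ ω =
      (Complex.exp (-Complex.I * (((K : ℝ) * ω : ℝ) : ℂ)) * δ) •
        (Amat b d T ω).map (starRingEnd ℂ) := by
    rw [hG, Matrix.smul_mul, Matrix.mul_assoc,
      conjTranspose_mul_self_of_mul_conjTranspose_self hδ' (hPU ω), Matrix.mul_smul,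
      Matrix.mul_one, smul_smul]
  have hdiag := congrFun (congrFun hGH 0) 0
  have halias := congrFun (congrFun hGH 0) 1
  simp only [Gmod, Hmod, Amat, Matrix.mul_apply, Fin.sum_univ_two, Matrix.smul_apply,
    Matrix.map_apply, Matrix.of_apply, Matrix.cons_val_zero, Matrix.cons_val_one,
    Matrix.cons_val', Matrix.cons_val_fin_one, smul_eq_mul, map_zero, mul_zero] at hdiag halias
  have hunit : Complex.exp (-Complex.I * ((d * b * ω ^ 2 / T ^ 2 : ℝ) : ℂ)) *
      starRingEnd ℂ (Complex.exp (-Complex.I * ((d * b * ω ^ 2 / T ^ 2 : ℝ) : ℂ))) = 1 := by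
    rw [← Complex.exp_conj, ← Complex.exp_add, map_mul, map_neg, Complex.conj_I,
      Complex.conj_ofReal, ← add_mul, add_neg_cancel, zero_mul, Complex.exp_zero]
  rw [funext hxhat, dtlct_add a b d T
      (finite_support_lctConv a b T hg₀
        (finite_support_up2_down2 (finite_support_lctConv a b T hh₀ hx)))
      (finite_support_lctConv a b T hg₁
        (finite_support_up2_down2 (finite_support_lctConv a b T hh₁ hx))),
    dtlct_channel a b d T hg₀ hh₀ hx, dtlct_channel a b d T hg₁ hh₁ hx]
  linear_combination
    Complex.exp (-Complex.I * ((d * b * ω ^ 2 / T ^ 2 : ℝ) : ℂ)) / 2 * dtlct a b d T x ω * hdiag +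
    Complex.exp (-Complex.I * ((d * b * (ω + Real.pi) ^ 2 / T ^ 2 : ℝ) : ℂ)) / 2 *
      dtlct a b d T x (ω + Real.pi) * halias +
    Complex.exp (-Complex.I * (((K : ℝ) * ω : ℝ) : ℂ)) * δ / 2 * dtlct a b d T x ω * hunit
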